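/- arXiv:2409.17466 — 2 statements merged into one kernel-verified Lean document; each statement's English description precedes it below -/
import Mathlib

section
/- Let P and Q be probability measures on the real line with cumulative distribution functions F_Y and G_Y, and let c be a real number. Let P_V and Q_V denote the pushforward measures of P and Q under the map y ↦ |y − c|, with cumulative distribution functions F_V and G_V. Then sup_{v ∈ ℝ} |F_V(v) − G_V(v)| ≤ 2 · sup_{y ∈ ℝ} |F_Y(y) − G_Y(y)|. -/
open MeasureTheory

/-- A bound on the difference of two distribution functions passes to open half-lines. -/
theorem abs_measureReal_Iio_sub_le {P Q : Measure ℝ} [IsFiniteMeasure P] [IsFiniteMeasure Q]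
    {K : ℝ} (h : ∀ y, |P.real (Set.Iic y) - Q.real (Set.Iic y)| ≤ K) (x : ℝ) :
    |P.real (Set.Iio x) - Q.real (Set.Iio x)| ≤ K := by
  obtain ⟨u, hu_mono, hu_lt, hu_tendsto⟩ := exists_seq_strictMono_tendsto x
  have key (μ : Measure ℝ) [IsFiniteMeasure μ] :
      Filter.Tendsto (fun n => μ.real (Set.Iic (u n))) Filter.atTop
        (nhds (μ.real (Set.Iio x))) := by
    rw [← iUnion_Iic_eq_Iio_of_lt_of_tendsto hu_lt hu_tendsto]
    exact (ENNReal.tendsto_toReal (measure_ne_top μ _)).comp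
      (tendsto_measure_iUnion_atTop fun _ _ hij => Set.Iic_subset_Iic.2 (hu_mono.monotone hij))
  exact le_of_tendsto ((key P).sub (key Q)).abs (Filter.Eventually.of_forall fun n => h (u n))

/-- A bound on the difference of two distribution functions doubles on closed intervals. -/
theorem abs_measureReal_Icc_sub_le {P Q : Measure ℝ} [IsFiniteMeasure P] [IsFiniteMeasure Q]
    {K : ℝ} (h : ∀ y, |P.real (Set.Iic y) - Q.real (Set.Iic y)| ≤ K) (a b : ℝ) :
    |P.real (Set.Icc a b) - Q.real (Set.Icc a b)| ≤ 2 * K := by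
  rcases lt_or_ge b a with hab | hab
  · simpa [Set.Icc_eq_empty hab.not_ge] using (abs_nonneg _).trans (h a)
  have key (μ : Measure ℝ) [IsFiniteMeasure μ] :
      μ.real (Set.Icc a b) = μ.real (Set.Iic b) - μ.real (Set.Iio a) := by
    have hsub : Set.Iio a ⊆ Set.Iic b := fun y hy => (le_of_lt hy).trans hab
    rw [← measureReal_sdiff hsub measurableSet_Iio]
    congr 1
    ext y
    simp
  have hb := abs_le.1 (h b)
  have ha := abs_le.1 (abs_measureReal_Iio_sub_le h a)
  rw [key P, key Q, abs_le]
  constructor <;> linarith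

/-- The Kolmogorov–Smirnov distance between the pushforwards of two probability
measures on `ℝ` under the residual score map `y ↦ |y - c|` is at most twice the KS distance
between the original measures. -/
theorem ks_residual_pushforward (P Q : Measure ℝ)
    [IsProbabilityMeasure P] [IsProbabilityMeasure Q] (c : ℝ) :
    (⨆ v : ℝ, |((P.map (fun y => |y - c|)) (Set.Iic v)).toReal -
        ((Q.map (fun y => |y - c|)) (Set.Iic v)).toReal|)
      ≤ 2 * ⨆ y : ℝ, |(P (Set.Iic y)).toReal - (Q (Set.Iic y)).toReal| := by
  have hbdd : BddAbove (Set.range fun y : ℝ =>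
      |(P (Set.Iic y)).toReal - (Q (Set.Iic y)).toReal|) := by
    refine ⟨1, ?_⟩
    rintro _ ⟨y, rfl⟩
    exact abs_sub_le_of_nonneg_of_le measureReal_nonneg measureReal_le_one
      measureReal_nonneg measureReal_le_one
  refine ciSup_le fun v => ?_
  have hmeas : Measurable fun y : ℝ => |y - c| := by fun_prop
  have hpre : (fun y : ℝ => |y - c|) ⁻¹' Set.Iic v = Set.Icc (c - v) (c + v) := by
    ext y
    simp only [Set.mem_preimage, Set.mem_Iic, Set.mem_Icc, abs_le]
    constructor <;> rintro ⟨_, _⟩ <;> constructor <;> linarith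
  rw [Measure.map_apply hmeas measurableSet_Iic, Measure.map_apply hmeas measurableSet_Iic, hpre]
  exact abs_measureReal_Icc_sub_le (fun y => le_ciSup hbdd y) _ _
end

section
/- Let P and Q be probability measures on the real line with cumulative distribution functions F_Y and G_Y, and let a and b be real numbers. Let P_V and Q_V denote the pushforward measures of P and Q under the map y ↦ max(a − y, y − b), with cumulative distribution functions F_V and G_V. Then sup_{v ∈ ℝ} |F_V(v) − G_V(v)| ≤ 2 · sup_{y ∈ ℝ} |F_Y(y) − G_Y(y)|. -/
open MeasureTheory

lemma bddAbove_range_abs_sub_measure_Iic (P Q : Measure ℝ)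
    [IsProbabilityMeasure P] [IsProbabilityMeasure Q] :
    BddAbove (Set.range fun y : ℝ => |P.real (Set.Iic y) - Q.real (Set.Iic y)|) := by
  refine ⟨1, ?_⟩
  rintro _ ⟨y, rfl⟩
  exact abs_sub_le_of_nonneg_of_le measureReal_nonneg measureReal_le_one
    measureReal_nonneg measureReal_le_one

lemma tendsto_measureReal_Iic_Iio (P : Measure ℝ) [IsFiniteMeasure P] {c : ℝ} {u : ℕ → ℝ}
    (hmono : Monotone u) (hlt : ∀ n, u n < c) (hu : Filter.Tendsto u Filter.atTop (nhds c)) :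
    Filter.Tendsto (fun n => P.real (Set.Iic (u n))) Filter.atTop (nhds (P.real (Set.Iio c))) := by
  have h := tendsto_measure_iUnion_atTop (μ := P)
    (s := fun n => Set.Iic (u n)) fun _ _ hmn => Set.Iic_subset_Iic.2 (hmono hmn)
  rw [iUnion_Iic_eq_Iio_of_lt_of_tendsto hlt hu] at h
  exact (ENNReal.tendsto_toReal (measure_ne_top P _)).comp h

lemma abs_sub_measure_Iio_le {P Q : Measure ℝ} [IsFiniteMeasure P] [IsFiniteMeasure Q] {S : ℝ}
    (hS : ∀ y, |P.real (Set.Iic y) - Q.real (Set.Iic y)| ≤ S) (c : ℝ) :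
    |P.real (Set.Iio c) - Q.real (Set.Iio c)| ≤ S := by
  obtain ⟨u, hmono, hlt, hu⟩ := exists_seq_strictMono_tendsto c
  exact le_of_tendsto' ((tendsto_measureReal_Iic_Iio P hmono.monotone hlt hu).sub
    (tendsto_measureReal_Iic_Iio Q hmono.monotone hlt hu)).abs fun n => hS (u n)

lemma measureReal_Icc_eq_sub (P : Measure ℝ) [IsFiniteMeasure P] {c d : ℝ} (h : c ≤ d) :
    P.real (Set.Icc c d) = P.real (Set.Iic d) - P.real (Set.Iio c) := by
  have hdiff : Set.Icc c d = Set.Iic d \ Set.Iio c := by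
    ext y
    simp
  rw [hdiff, measureReal_sdiff (Set.Iio_subset_Iic_self.trans (Set.Iic_subset_Iic.2 h))
    measurableSet_Iio]

lemma abs_sub_measure_Icc_le {P Q : Measure ℝ} [IsFiniteMeasure P] [IsFiniteMeasure Q] {S : ℝ}
    (hS : ∀ y, |P.real (Set.Iic y) - Q.real (Set.Iic y)| ≤ S) (c d : ℝ) :
    |P.real (Set.Icc c d) - Q.real (Set.Icc c d)| ≤ 2 * S := by
  rcases le_or_gt c d with h | h
  · rw [measureReal_Icc_eq_sub P h, measureReal_Icc_eq_sub Q h]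
    have hd := abs_le.1 (hS d)
    have hc := abs_le.1 (abs_sub_measure_Iio_le hS c)
    rw [abs_le]
    constructor <;> linarith [hd.1, hd.2, hc.1, hc.2]
  · simpa [Set.Icc_eq_empty_of_lt h] using (abs_nonneg _).trans (hS 0)

lemma measureReal_map_max_sub_sub_Iic (P : Measure ℝ) (a b v : ℝ) :
    (P.map (fun y => max (a - y) (y - b))).real (Set.Iic v) =
      P.real (Set.Icc (a - v) (b + v)) := by
  rw [map_measureReal_apply (by fun_prop) measurableSet_Iic]
  congr 1
  ext y
  simp only [Set.mem_preimage, Set.mem_Iic, max_le_iff, Set.mem_Icc]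
  constructor <;> rintro ⟨h₁, h₂⟩ <;> constructor <;> linarith

/-- The Kolmogorov–Smirnov distance between the pushforwards of two probability
measures on `ℝ` under the quantile score map `y ↦ max (a - y) (y - b)` is at most twice the
KS distance between the original measures. -/
theorem ks_quantile_pushforward (P Q : Measure ℝ)
    [IsProbabilityMeasure P] [IsProbabilityMeasure Q] (a b : ℝ) :
    (⨆ v : ℝ, |((P.map (fun y => max (a - y) (y - b))) (Set.Iic v)).toReal -
        ((Q.map (fun y => max (a - y) (y - b))) (Set.Iic v)).toReal|)
      ≤ 2 * ⨆ y : ℝ, |(P (Set.Iic y)).toReal - (Q (Set.Iic y)).toReal| := by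
  refine ciSup_le fun v => ?_
  have h := abs_sub_measure_Icc_le
    (le_ciSup (bddAbove_range_abs_sub_measure_Iic P Q)) (a - v) (b + v)
  rw [← measureReal_map_max_sub_sub_Iic P, ← measureReal_map_max_sub_sub_Iic Q] at h
  exact h
end
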